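/- Let Γ = ℕ \ {1}, S = {(a,b) ∈ ℤ² : a ∈ Γ and b ≥ 0}, and JMon = {(a,b) ∈ ℤ² : a ≥ 2 and b ≥ 1}. For every d ∈ ℤ², the ideal of ℂ[θ₁,θ₂] given by the sum Σ_{m ∈ JMon} I(Ω(d − m)) of the vanishing ideals of the sets Ω(d − m) over all m ∈ JMon equals the vanishing ideal of {a ∈ S : a + d ∉ JMon}. (This expresses the equality JD(R_A) = D(R_A, J) in every multidegree for the non-normal ring R_A = ℂ[s²,s³,t] with J = ⟨s²t, s³t⟩.) -/

import Mathlib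

open MvPolynomial

noncomputable section

/-- The polynomial ring ℂ[θ₁, θ₂]. -/
abbrev Cθ : Type := MvPolynomial (Fin 2) ℂ

/-- The vanishing ideal of a set `V ⊆ ℤ²` inside ℂ[θ₁, θ₂]. -/
def vanishingIdeal (V : Set (ℤ × ℤ)) : Ideal Cθ where
  carrier := {f | ∀ a ∈ V, eval ![(a.1 : ℂ), (a.2 : ℂ)] f = 0}
  add_mem' := by
    intro f g hf hg a ha
    simp [map_add, hf a ha, hg a ha]
  zero_mem' := by
    intro a _
    simp
  smul_mem' := by
    intro c f hf a ha
    simp [smul_eq_mul, hf a ha]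

/-- The descending factorial `(P, m)! = ∏_{j=0}^{m} (P - j)`, equal to `1` when `m < 0`. -/
def dfact (P : Cθ) (m : ℤ) : Cθ :=
  ∏ j ∈ Finset.range (m + 1).toNat, (P - C (j : ℂ))

/-- `Γ = ℕ \ {1} ⊆ ℤ`, the numerical semigroup generated by `2` and `3`. -/
def Gam : Set ℤ := {a | 0 ≤ a ∧ a ≠ 1}

/-- `S = Γ × ℕ ⊆ ℤ²`, the exponent set of the non-normal affine semigroup ring
`R_A = ℂ[s², s³, t]`. -/
def SsetG : Set (ℤ × ℤ) := {a | a.1 ∈ Gam ∧ 0 ≤ a.2}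

/-- `Ω(d) = {a ∈ S : a + d ∉ S}`. -/
def OmegaG (d : ℤ × ℤ) : Set (ℤ × ℤ) := {a | a ∈ SsetG ∧ a + d ∉ SsetG}

/-- `JMon = {(a, b) : a ≥ 2, b ≥ 1}`, the exponents of monomials of the radical interior
ideal `J = ⟨s²t, s³t⟩` of `R_A`. -/
def JMonG : Set (ℤ × ℤ) := {a | 2 ≤ a.1 ∧ 1 ≤ a.2}

lemma vanishingIdeal_anti {V W : Set (ℤ × ℤ)} (h : V ⊆ W) :
    vanishingIdeal W ≤ vanishingIdeal V :=
  fun _ hf a ha => hf a (h ha)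

/-- `θ₁ - k`, the equation of the vertical line through `k`. -/
def verticalLine (k : ℤ) : Cθ := X 0 - C (k : ℂ)

lemma eval_verticalLine (k : ℤ) (a : ℤ × ℤ) :
    eval ![(a.1 : ℂ), (a.2 : ℂ)] (verticalLine k) = ((a.1 - k : ℤ) : ℂ) := by
  simp [verticalLine]

lemma verticalLine_bezout (k : ℤ) :
    verticalLine (k + 1) ^ 2 - verticalLine k * verticalLine (k + 2) = 1 := by
  simp only [verticalLine, Int.cast_add, Int.cast_one, Int.cast_ofNat, map_add, map_one,
    map_ofNat]
  ring

/-- For the non-normal ring `R_A = ℂ[s², s³, t]` with `J = ⟨s²t, s³t⟩`, in every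
multidegree `d` the sum `Σ_{m ∈ JMon} I(Ω(d − m))` equals the vanishing ideal of
`{a ∈ S : a + d ∉ JMon}`; that is, `J D(R_A) = D(R_A, J)`. -/
theorem statement17 (d : ℤ × ℤ) :
    (⨆ m ∈ JMonG, vanishingIdeal (OmegaG (d - m))) =
      vanishingIdeal {a | a ∈ SsetG ∧ a + d ∉ JMonG} := by
  apply le_antisymm
  · refine iSup₂_le fun m hm => vanishingIdeal_anti ?_
    rintro a ⟨haS, ha⟩
    refine ⟨haS, fun h => ha ?_⟩
    simp only [SsetG, Gam, JMonG, Set.mem_ofPred_eq, Prod.fst_add, Prod.snd_add, Prod.fst_sub,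
      Prod.snd_sub] at h hm ⊢
    omega
  · intro f hf
    have h₁ : f * verticalLine (2 - d.1 + 1) ^ 2 ∈ vanishingIdeal (OmegaG (d - (2, 1))) := by
      rintro a ⟨haS, ha⟩
      by_cases hT : a + d ∈ JMonG
      · have hline : a.1 - (2 - d.1 + 1) = 0 := by
          simp only [SsetG, Gam, JMonG, Set.mem_ofPred_eq, Prod.fst_add, Prod.snd_add,
            Prod.fst_sub, Prod.snd_sub] at ha hT
          omega
        rw [map_mul, map_pow, eval_verticalLine, hline]
        simp
      · rw [map_mul, hf a ⟨haS, hT⟩, zero_mul]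
    have h₂ : f * (verticalLine (2 - d.1) * verticalLine (2 - d.1 + 2)) ∈
        vanishingIdeal (OmegaG (d - (3, 1))) := by
      rintro a ⟨haS, ha⟩
      by_cases hT : a + d ∈ JMonG
      · have hline : a.1 - (2 - d.1) = 0 ∨ a.1 - (2 - d.1 + 2) = 0 := by
          simp only [SsetG, Gam, JMonG, Set.mem_ofPred_eq, Prod.fst_add, Prod.snd_add,
            Prod.fst_sub, Prod.snd_sub] at ha hT
          omega
        rw [map_mul, map_mul, eval_verticalLine, eval_verticalLine]
        rcases hline with h | h <;> rw [h] <;> simp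
      · rw [map_mul, hf a ⟨haS, hT⟩, zero_mul]
    have hsum : f = f * verticalLine (2 - d.1 + 1) ^ 2 -
        f * (verticalLine (2 - d.1) * verticalLine (2 - d.1 + 2)) := by
      rw [← mul_sub, verticalLine_bezout, mul_one]
    rw [hsum]
    exact sub_mem
      (Submodule.mem_iSup_of_mem _ (Submodule.mem_iSup_of_mem (by simp [JMonG]) h₁))
      (Submodule.mem_iSup_of_mem _ (Submodule.mem_iSup_of_mem (by simp [JMonG]) h₂))

end
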